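/- arXiv:2509.09518 — 4 statements merged into one kernel-verified Lean document; each statement's English description precedes it below -/
import Mathlib

section
/- Let d ≥ 1, h > 0, and fix (τ_♮, ξ_♮) ∈ ℝ × ℝ^d with ξ_{♮,1} ≠ 0. On U = {(t, x) ∈ ℝ × ℝ^d : x₁ ≠ 0} define s(t,x) = t/x₁ + h(τ_♮ + 1)/ξ_{♮,1}, w_j(t,x) = x_j/x₁ − ξ_{♮,j}/ξ_{♮,1} for 2 ≤ j ≤ d, and ρ(t,x) = 1/x₁. Let X be the constant-coefficient vector field X = h(τ_♮ + 1) ∂_t − Σ_{j=1}^d ξ_{♮,j} ∂_{x_j}. Then on U: x₁ · (X s) = ξ_{♮,1} s, x₁ · (X w_j) = ξ_{♮,1} w_j for each 2 ≤ j ≤ d, and x₁ · (X ρ) = ξ_{♮,1} ρ. That is, in the coordinates (s, w, ρ) the rescaled Hamiltonian vector field x₁ X equals ξ_{♮,1}(s ∂_s + w·∂_w + ρ ∂_ρ), so the locus {s = 0, w = 0, ρ = 0} is a nondegenerate radial source or sink according to the sign of ξ_{♮,1}. -/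
/-- Partial derivative in the time variable of a real-valued function on `ℝ × ℝ^d`. -/
noncomputable def PtR (d : ℕ) (f : ℝ × (Fin d → ℝ) → ℝ) (p : ℝ × (Fin d → ℝ)) : ℝ :=
  fderiv ℝ f p (1, 0)

/-- Partial derivative in the `j`-th spatial variable of a real-valued function. -/
noncomputable def PxR (d : ℕ) (j : Fin d) (f : ℝ × (Fin d → ℝ) → ℝ)
    (p : ℝ × (Fin d → ℝ)) : ℝ :=
  fderiv ℝ f p (0, Pi.single j 1)

/-- The frozen-frequency rescaled Hamiltonian vector field
`X = h (τ♮ + 1) ∂_t − Σ_{j=1}^d ξ♮_j ∂_{x_j}` applied to a function. -/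
noncomputable def Ham (d : ℕ) (h τ : ℝ) (ξ : Fin d → ℝ) (f : ℝ × (Fin d → ℝ) → ℝ)
    (p : ℝ × (Fin d → ℝ)) : ℝ :=
  h * (τ + 1) * PtR d f p - ∑ j, ξ j * PxR d j f p

/-- The vector field `X` is the directional derivative along `(h (τ + 1), -ξ)`. -/
theorem Ham_eq_of_hasFDerivAt {d : ℕ} {h τ : ℝ} {ξ : Fin d → ℝ} {f : ℝ × (Fin d → ℝ) → ℝ}
    {p : ℝ × (Fin d → ℝ)} {L : ℝ × (Fin d → ℝ) →L[ℝ] ℝ} (hf : HasFDerivAt f L p) :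
    Ham d h τ ξ f p = L (h * (τ + 1), -ξ) := by
  have hv : ((h * (τ + 1), -ξ) : ℝ × (Fin d → ℝ)) =
      (h * (τ + 1)) • ((1, 0) : ℝ × (Fin d → ℝ)) -
        ∑ j, ξ j • ((0, Pi.single j 1) : ℝ × (Fin d → ℝ)) := by
    ext k
    · simp [Prod.fst_sum]
    · simp [Prod.snd_sum, Finset.sum_apply, Pi.single_apply]
  rw [hv, map_sub, map_smul, map_sum]
  simp only [map_smul, smul_eq_mul, Ham, PtR, PxR, hf.fderiv]

/-- The vector field `X` applied to the quotient of a differentiable function by a nonvanishing spatial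
coordinate, up to an additive constant. -/
theorem Ham_div_coord_add_const {d : ℕ} (h τ : ℝ) (ξ : Fin d → ℝ) (i : Fin d)
    {a : ℝ × (Fin d → ℝ) → ℝ} {A : ℝ × (Fin d → ℝ) →L[ℝ] ℝ} (c : ℝ) {p : ℝ × (Fin d → ℝ)}
    (ha : HasFDerivAt a A p) (hp : p.2 i ≠ 0) :
    Ham d h τ ξ (fun q => a q / q.2 i + c) p =
      A (h * (τ + 1), -ξ) / p.2 i + a p * ξ i / p.2 i ^ 2 := by
  have hx : HasFDerivAt (fun q : ℝ × (Fin d → ℝ) => q.2 i)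
      ((ContinuousLinearMap.proj i).comp (ContinuousLinearMap.snd ℝ ℝ (Fin d → ℝ))) p :=
    ContinuousLinearMap.hasFDerivAt
      ((ContinuousLinearMap.proj (R := ℝ) (φ := fun _ : Fin d => ℝ) i).comp
        (ContinuousLinearMap.snd ℝ ℝ (Fin d → ℝ)))
  have hq := (ha.mul ((hasDerivAt_inv hp).comp_hasFDerivAt p hx)).add_const c
  have hX := Ham_eq_of_hasFDerivAt (h := h) (τ := τ) (ξ := ξ) hq
  refine hX.trans ?_
  simp
  field_simp
  ring

/-- In the coordinates `(s, w, ρ)` the rescaled Hamiltonian vector field `x₁ X` equals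
`ξ♮₁ (s ∂_s + w·∂_w + ρ ∂_ρ)`: the key coordinate computation for the radial sets
(Proposition 4.5). -/
theorem radial_set_coordinates_natural_face (d : ℕ) (hd : 0 < d) (h τ : ℝ) (hh : 0 < h)
    (ξ : Fin d → ℝ) (hξ : ξ ⟨0, hd⟩ ≠ 0) :
    let i1 : Fin d := ⟨0, hd⟩
    let s : ℝ × (Fin d → ℝ) → ℝ := fun p => p.1 / p.2 i1 + h * (τ + 1) / ξ i1
    let w : Fin d → ℝ × (Fin d → ℝ) → ℝ := fun j p => p.2 j / p.2 i1 - ξ j / ξ i1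
    let ρ : ℝ × (Fin d → ℝ) → ℝ := fun p => (p.2 i1)⁻¹
    ∀ p : ℝ × (Fin d → ℝ), p.2 i1 ≠ 0 →
      p.2 i1 * Ham d h τ ξ s p = ξ i1 * s p ∧
      (∀ j : Fin d, j ≠ i1 → p.2 i1 * Ham d h τ ξ (w j) p = ξ i1 * w j p) ∧
      p.2 i1 * Ham d h τ ξ ρ p = ξ i1 * ρ p := by
  intro i1 s w ρ p hp
  replace hξ : ξ i1 ≠ 0 := hξ
  refine ⟨?_, fun j _ => ?_, ?_⟩
  · have := Ham_div_coord_add_const h τ ξ i1 (h * (τ + 1) / ξ i1)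
      (hasFDerivAt_fst (𝕜 := ℝ) (p := p)) hp
    simp only [s, this, ContinuousLinearMap.coe_fst']
    field_simp
    ring
  · have := Ham_div_coord_add_const h τ ξ i1 (-(ξ j / ξ i1))
      (ContinuousLinearMap.hasFDerivAt (x := p)
        ((ContinuousLinearMap.proj (R := ℝ) (φ := fun _ : Fin d => ℝ) j).comp
          (ContinuousLinearMap.snd ℝ ℝ (Fin d → ℝ)))) hp
    simp only [ContinuousLinearMap.comp_apply, ContinuousLinearMap.coe_snd',
      ContinuousLinearMap.proj_apply, Pi.neg_apply, ← sub_eq_add_neg] at this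
    simp only [w, this]
    field_simp
    ring
  · have := Ham_div_coord_add_const h τ ξ i1 0 (hasFDerivAt_const (𝕜 := ℝ) (1 : ℝ) p) hp
    simp only [one_div, add_zero, zero_apply, zero_div, zero_add,
      one_mul] at this
    simp only [ρ, this]
    field_simp
end

section
/- Let D ≥ 1 and let a, b be Schwartz functions on ℝ^D_z × ℝ^D_ζ. Define c(z, ζ) = (2π)^{−D} ∬_{ℝ^D × ℝ^D} e^{−i w·η} a(z, ζ+η) b(z+w, ζ) dw dη (an absolutely convergent integral). Then for every Schwartz function f on ℝ^D one has Op(a)(Op(b) f) = Op(c) f, where Op denotes the standard left quantization. In other words, the left-reduced symbol of the composition of two quantizations with Schwartz symbols is given by the exact Moyal-product integral formula. -/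
open MeasureTheory

/-- The standard left quantization on `ℝ^D`:
`Op(a)f(z) = (2π)^{−D} ∬ e^{i(z−z')·ζ} a(z,ζ) f(z') dz' dζ`. -/
noncomputable def OpL (D : ℕ) (a : (Fin D → ℝ) × (Fin D → ℝ) → ℂ)
    (f : (Fin D → ℝ) → ℂ) (z : Fin D → ℝ) : ℂ :=
  ((((2 * Real.pi) ^ D)⁻¹ : ℝ) : ℂ) *
    ∫ q : (Fin D → ℝ) × (Fin D → ℝ),
      Complex.exp (Complex.I * ((∑ i, (z i - q.1 i) * q.2 i : ℝ) : ℂ)) *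
        a (z, q.2) * f q.1

/-- The exact Moyal-product integral:
`(a ⋆ b)(z,ζ) = (2π)^{−D} ∬ e^{−i w·η} a(z, ζ+η) b(z+w, ζ) dw dη`. -/
noncomputable def moyalProd (D : ℕ) (a b : (Fin D → ℝ) × (Fin D → ℝ) → ℂ)
    (p : (Fin D → ℝ) × (Fin D → ℝ)) : ℂ :=
  ((((2 * Real.pi) ^ D)⁻¹ : ℝ) : ℂ) *
    ∫ q : (Fin D → ℝ) × (Fin D → ℝ),
      Complex.exp (-(Complex.I * ((∑ i, q.1 i * q.2 i : ℝ) : ℂ))) *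
        a (p.1, p.2 + q.2) * b (p.1 + q.1, p.2)

/-- Interchanging the second components of two pairs preserves the product measure. -/
theorem measurePreserving_prod_swap_snd {α β γ δ : Type*} [MeasurableSpace α] [MeasurableSpace β]
    [MeasurableSpace γ] [MeasurableSpace δ] (μ : Measure α) (ν : Measure β) (ρ : Measure γ)
    (τ : Measure δ) [SFinite μ] [SFinite ν] [SFinite ρ] [SFinite τ] :
    MeasurePreserving (fun p : (α × β) × (γ × δ) => ((p.1.1, p.2.2), (p.2.1, p.1.2)))
      ((μ.prod ν).prod (ρ.prod τ)) ((μ.prod τ).prod (ρ.prod ν)) :=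
  (measurePreserving_prodAssoc μ τ (ρ.prod ν)).symm.comp <|
    ((MeasurePreserving.id μ).prod <|
      (measurePreserving_prodAssoc τ ρ ν).comp <|
        (Measure.measurePreserving_swap.prod (MeasurePreserving.id ν)).comp
          Measure.measurePreserving_swap).comp
      (measurePreserving_prodAssoc μ ν (ρ.prod τ))

/-- The restriction of a Schwartz function on a product to a vertical slice is integrable. -/
theorem SchwartzMap.integrable_prodMk_left {E F V : Type*}
    [NormedAddCommGroup E] [NormedSpace ℝ E]
    [NormedAddCommGroup F] [NormedSpace ℝ F]
    [NormedAddCommGroup V] [NormedSpace ℝ V]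
    [MeasurableSpace F] [BorelSpace F] [SecondCountableTopology F]
    {μ : Measure F} [μ.HasTemperateGrowth] (g : SchwartzMap (E × F) V) (x : E) :
    Integrable (fun y => g (x, y)) μ := by
  have hg : (fun y : F => (x, y)).HasTemperateGrowth := by
    have h := (Function.HasTemperateGrowth.const (E := F) (x, (0 : F))).add
      (ContinuousLinearMap.inr ℝ E F).hasTemperateGrowth
    convert h using 1
    ext y <;> simp
  have hanti : AntilipschitzWith 1 (fun y : F => (x, y)) :=
    AntilipschitzWith.of_le_mul_dist fun y y' => by simp [Prod.dist_eq]
  exact (SchwartzMap.compCLMOfAntilipschitz ℝ hg hanti g).integrable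

/-- The integrand of the fourfold integral that expresses `Op(a) (Op(b) f)` at `z`, as a function
of `q = (y, η)` (outer quantization) and `r = (x, ξ)` (inner quantization). -/
noncomputable def compIntegrand {D : ℕ} (a b : (Fin D → ℝ) × (Fin D → ℝ) → ℂ)
    (f : (Fin D → ℝ) → ℂ) (z : Fin D → ℝ) (q r : (Fin D → ℝ) × (Fin D → ℝ)) : ℂ :=
  Complex.exp (Complex.I * ((∑ i, (z i - q.1 i) * q.2 i : ℝ) : ℂ)) * a (z, q.2) *
    (Complex.exp (Complex.I * ((∑ i, (q.1 i - r.1 i) * r.2 i : ℝ) : ℂ)) * b (q.1, r.2) * f r.1)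

theorem integrable_compIntegrand {D : ℕ}
    (a b : SchwartzMap ((Fin D → ℝ) × (Fin D → ℝ)) ℂ)
    (f : SchwartzMap (Fin D → ℝ) ℂ) (z : Fin D → ℝ) :
    Integrable (Function.uncurry (compIntegrand a b f z)) (volume.prod volume) := by
  have : (volume : Measure ((Fin D → ℝ) × (Fin D → ℝ))).IsAddHaarMeasure :=
    Measure.prod.instIsAddHaarMeasure volume volume
  have hprod : Integrable
      (fun p : ((Fin D → ℝ) × (Fin D → ℝ)) × ((Fin D → ℝ) × (Fin D → ℝ)) =>
        b p.1 * (f p.2.1 * a (z, p.2.2))) (volume.prod volume) :=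
    b.integrable.mul_prod (f.integrable.mul_prod (a.integrable_prodMk_left z))
  have hswap := (measurePreserving_prod_swap_snd (volume : Measure (Fin D → ℝ))
    (volume : Measure (Fin D → ℝ)) (volume : Measure (Fin D → ℝ))
    (volume : Measure (Fin D → ℝ))).integrable_comp_of_integrable hprod
  refine hswap.mono ?_ (.of_forall fun p => le_of_eq ?_)
  · have ha := a.continuous
    have hb := b.continuous
    have hf := f.continuous
    refine Continuous.aestronglyMeasurable ?_
    unfold compIntegrand Function.uncurry
    fun_prop
  · simp only [Function.uncurry, compIntegrand, Function.comp_apply, norm_mul,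
      mul_comm Complex.I, Complex.norm_exp_ofReal_mul_I]
    ring

/-- Integrating `compIntegrand` in the outer variables first produces the Moyal product. -/
theorem integral_compIntegrand_left {D : ℕ} (a b : (Fin D → ℝ) × (Fin D → ℝ) → ℂ)
    (f : (Fin D → ℝ) → ℂ) (z : Fin D → ℝ) (r : (Fin D → ℝ) × (Fin D → ℝ)) :
    ((((2 * Real.pi) ^ D)⁻¹ : ℝ) : ℂ) * ∫ q, compIntegrand a b f z q r =
      Complex.exp (Complex.I * ((∑ i, (z i - r.1 i) * r.2 i : ℝ) : ℂ)) *
        moyalProd D a b (z, r.2) * f r.1 := by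
  have : (volume : Measure ((Fin D → ℝ) × (Fin D → ℝ))).IsAddHaarMeasure :=
    Measure.prod.instIsAddHaarMeasure volume volume
  rw [moyalProd, ← integral_add_left_eq_self _ (z, r.2), mul_left_comm, mul_assoc]
  congr 1
  rw [← integral_const_mul, ← integral_mul_const]
  congr 1 with q
  have hphase : Complex.exp (Complex.I * ((∑ i, (z i - (z i + q.1 i)) * (r.2 i + q.2 i) : ℝ) : ℂ)) *
        Complex.exp (Complex.I * ((∑ i, (z i + q.1 i - r.1 i) * r.2 i : ℝ) : ℂ)) =
      Complex.exp (Complex.I * ((∑ i, (z i - r.1 i) * r.2 i : ℝ) : ℂ)) *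
        Complex.exp (-(Complex.I * ((∑ i, q.1 i * q.2 i : ℝ) : ℂ))) := by
    rw [← Complex.exp_add, ← Complex.exp_add, ← mul_add, ← mul_neg, ← mul_add,
      ← Complex.ofReal_neg, ← Complex.ofReal_add, ← Complex.ofReal_add, ← Finset.sum_neg_distrib,
      ← Finset.sum_add_distrib, ← Finset.sum_add_distrib]
    congr 3
    exact Finset.sum_congr rfl fun i _ => by ring
  simp only [compIntegrand, Prod.fst_add, Prod.snd_add, Pi.add_apply]
  linear_combination a (z, r.2 + q.2) * b (z + q.1, r.2) * f r.1 * hphase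

/-- The left-reduced symbol of the composition of two quantizations with Schwartz symbols
is given by the exact Moyal-product integral formula (analytic core of the composition
laws, Propositions 2.1, 2.10 and D.3). -/
theorem moyal_composition (D : ℕ) (hD : 1 ≤ D)
    (a b : SchwartzMap ((Fin D → ℝ) × (Fin D → ℝ)) ℂ)
    (f : SchwartzMap (Fin D → ℝ) ℂ) (z : Fin D → ℝ) :
    OpL D (fun r => a r) (OpL D (fun r => b r) (fun y => f y)) z
      = OpL D (moyalProd D (fun r => a r) (fun r => b r)) (fun y => f y) z := by
  have hleft : ∀ q : (Fin D → ℝ) × (Fin D → ℝ),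
      Complex.exp (Complex.I * ((∑ i, (z i - q.1 i) * q.2 i : ℝ) : ℂ)) * a (z, q.2) *
          OpL D (fun r => b r) (fun y => f y) q.1 =
        ((((2 * Real.pi) ^ D)⁻¹ : ℝ) : ℂ) * ∫ r, compIntegrand a b f z q r := by
    intro q
    simp only [OpL, compIntegrand]
    rw [integral_const_mul, mul_left_comm]
  rw [OpL]
  simp_rw [hleft]
  rw [integral_const_mul, integral_integral_swap (integrable_compIntegrand a b f z),
    ← integral_const_mul]
  simp_rw [integral_compIntegrand_left]
  rfl
end

section
/- Under the hypotheses in the context, the mass M(t) = ∫_{ℝ^d} |v(t,x)|² dx is differentiable in t and, for every t ∈ ℝ, M'(t) = ∫_{ℝ^d} ( (1/2) div_x B(t,x) − Im V(t,x) ) |v(t,x)|² dx, where div_x B = Σ_{j=1}^d ∂_{x_j} B_j. In particular, if B is divergence-free and V is real-valued, then M is constant (conservation of mass). -/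
open MeasureTheory

/-- Partial derivative in time of a function on spacetime `ℝ × ℝ^d`. -/
noncomputable def Ptc (d : ℕ) (v : ℝ × EuclideanSpace ℝ (Fin d) → ℂ)
    (p : ℝ × EuclideanSpace ℝ (Fin d)) : ℂ :=
  fderiv ℝ v p (1, 0)

/-- Partial derivative in the `j`-th spatial variable. -/
noncomputable def Pxc (d : ℕ) (j : Fin d) (v : ℝ × EuclideanSpace ℝ (Fin d) → ℂ)
    (p : ℝ × EuclideanSpace ℝ (Fin d)) : ℂ :=
  fderiv ℝ v p (0, EuclideanSpace.single j 1)

/-- Partial derivative in the `j`-th spatial variable of a real-valued function. -/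
noncomputable def Pxr (d : ℕ) (j : Fin d) (f : ℝ × EuclideanSpace ℝ (Fin d) → ℝ)
    (p : ℝ × EuclideanSpace ℝ (Fin d)) : ℝ :=
  fderiv ℝ f p (0, EuclideanSpace.single j 1)

section Decay

variable {E F G H : Type*} [NormedAddCommGroup E] [NormedAddCommGroup F] [NormedAddCommGroup G]
  [NormedAddCommGroup H]

/-- Decay in space faster than every power, locally uniformly in time. -/
def RapidDecay (f : ℝ × E → F) : Prop :=
  ∀ (R : ℝ) (k : ℕ), ∃ C : ℝ, ∀ t : ℝ, |t| ≤ R → ∀ x : E, (1 + ‖x‖) ^ k * ‖f (t, x)‖ ≤ C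

/-- At most polynomial growth in space, locally uniformly in time. -/
def SpatialPolyGrowth (g : ℝ × E → G) : Prop :=
  ∀ R : ℝ, ∃ (C : ℝ) (k : ℕ), ∀ t : ℝ, |t| ≤ R → ∀ x : E, ‖g (t, x)‖ ≤ C * (1 + ‖x‖) ^ k

theorem RapidDecay.of_pow_mul_le {f : ℝ × E → F}
    (hf : ∀ (R : ℝ) (k : ℕ), ∃ C : ℝ, ∀ t : ℝ, |t| ≤ R → ∀ x : E, ‖x‖ ^ k * ‖f (t, x)‖ ≤ C) :
    RapidDecay f := by
  intro R k
  obtain ⟨C₀, h₀⟩ := hf R 0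
  obtain ⟨C, h⟩ := hf R k
  refine ⟨2 ^ (k - 1) * (C₀ + C), fun t ht x => ?_⟩
  calc (1 + ‖x‖) ^ k * ‖f (t, x)‖
      ≤ 2 ^ (k - 1) * (1 ^ k + ‖x‖ ^ k) * ‖f (t, x)‖ := by
        gcongr
        exact add_pow_le zero_le_one (norm_nonneg x) k
    _ = 2 ^ (k - 1) * (‖x‖ ^ 0 * ‖f (t, x)‖ + ‖x‖ ^ k * ‖f (t, x)‖) := by ring
    _ ≤ 2 ^ (k - 1) * (C₀ + C) := by
        gcongr
        exacts [h₀ t ht x, h t ht x]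

theorem RapidDecay.spatialPolyGrowth {f : ℝ × E → F} (hf : RapidDecay f) :
    SpatialPolyGrowth f := fun R => by
  obtain ⟨C, h⟩ := hf R 0
  exact ⟨C, 0, fun t ht x => by simpa using h t ht x⟩

theorem RapidDecay.of_norm_le_mul {f : ℝ × E → F} {g : ℝ × E → G} {h : ℝ × E → H}
    (hf : RapidDecay f) (hg : SpatialPolyGrowth g) (hh : ∀ p, ‖h p‖ ≤ ‖f p‖ * ‖g p‖) :
    RapidDecay h := by
  intro R k
  obtain ⟨C, l, hC⟩ := hg R
  obtain ⟨D, hD⟩ := hf R (k + l)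
  refine ⟨|C| * D, fun t ht x => ?_⟩
  calc (1 + ‖x‖) ^ k * ‖h (t, x)‖
      ≤ (1 + ‖x‖) ^ k * (‖f (t, x)‖ * (|C| * (1 + ‖x‖) ^ l)) := by
        gcongr
        refine (hh _).trans ?_
        gcongr
        refine (hC t ht x).trans ?_
        gcongr
        exact le_abs_self C
    _ = |C| * ((1 + ‖x‖) ^ (k + l) * ‖f (t, x)‖) := by ring
    _ ≤ |C| * D := by gcongr; exact hD t ht x

theorem RapidDecay.add {f g : ℝ × E → F} (hf : RapidDecay f) (hg : RapidDecay g) :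
    RapidDecay fun p => f p + g p := by
  intro R k
  obtain ⟨C, hC⟩ := hf R k
  obtain ⟨D, hD⟩ := hg R k
  refine ⟨C + D, fun t ht x => ?_⟩
  calc (1 + ‖x‖) ^ k * ‖f (t, x) + g (t, x)‖
      ≤ (1 + ‖x‖) ^ k * (‖f (t, x)‖ + ‖g (t, x)‖) := by gcongr; exact norm_add_le _ _
    _ = (1 + ‖x‖) ^ k * ‖f (t, x)‖ + (1 + ‖x‖) ^ k * ‖g (t, x)‖ := by ring
    _ ≤ C + D := add_le_add (hC t ht x) (hD t ht x)

theorem RapidDecay.const_mul {f : ℝ × E → ℝ} (hf : RapidDecay f) (c : ℝ) :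
    RapidDecay fun p => c * f p :=
  hf.of_norm_le_mul (g := fun _ => c) (fun _ => ⟨‖c‖, 0, fun _ _ _ => by simp⟩)
    fun p => by simp [mul_comm]

theorem RapidDecay.mul {f g : ℝ × E → ℝ} (hf : RapidDecay f) (hg : SpatialPolyGrowth g) :
    RapidDecay fun p => g p * f p :=
  hf.of_norm_le_mul hg fun p => by rw [norm_mul, mul_comm]

theorem RapidDecay.inner {f g : ℝ × E → ℂ} (hf : RapidDecay f) (hg : RapidDecay g) :
    RapidDecay fun p => inner ℝ (f p) (g p) :=
  hf.of_norm_le_mul hg.spatialPolyGrowth fun _ => norm_inner_le_norm _ _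

theorem RapidDecay.I_mul {f : ℝ × E → ℂ} (hf : RapidDecay f) :
    RapidDecay fun p => Complex.I * f p :=
  hf.of_norm_le_mul (g := fun _ => (1 : ℝ)) (fun _ => ⟨1, 0, fun _ _ _ => by simp⟩)
    fun p => by simp

theorem SpatialPolyGrowth.im {g : ℝ × E → ℂ} (hg : SpatialPolyGrowth g) :
    SpatialPolyGrowth fun p => (g p).im := fun R => by
  obtain ⟨C, k, h⟩ := hg R
  exact ⟨C, k, fun t ht x => (Complex.abs_im_le_norm _).trans (h t ht x)⟩

theorem SpatialPolyGrowth.of_norm_le {g : ℝ × E → G} {C : ℝ} {k : ℕ}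
    (hg : ∀ p, ‖g p‖ ≤ C * (1 + ‖p‖) ^ k) : SpatialPolyGrowth g := by
  refine fun R => ⟨|C| * (1 + |R|) ^ k, k, fun t ht x => (hg _).trans ?_⟩
  rw [mul_assoc, ← mul_pow]
  gcongr
  · exact le_abs_self C
  · have h₁ : ‖(t, x)‖ ≤ |R| + ‖x‖ := by
      rw [Prod.norm_mk, Real.norm_eq_abs]
      have := le_abs_self R
      exact max_le (by linarith [norm_nonneg x]) (by linarith [abs_nonneg R])
    nlinarith [mul_nonneg (abs_nonneg R) (norm_nonneg x)]

variable [NormedSpace ℝ E] [FiniteDimensional ℝ E] [MeasurableSpace E] [BorelSpace E]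

theorem RapidDecay.exists_integrable_bound (μ : Measure E) [μ.IsAddHaarMeasure]
    {f : ℝ × E → F} (hf : RapidDecay f) (R : ℝ) :
    ∃ b : E → ℝ, Integrable b μ ∧ ∀ t : ℝ, |t| ≤ R → ∀ x, ‖f (t, x)‖ ≤ b x := by
  obtain ⟨C, hC⟩ := hf R (Module.finrank ℝ E + 1)
  refine ⟨fun x => C * (1 + ‖x‖) ^ (-((Module.finrank ℝ E + 1 : ℕ) : ℝ)),
    (integrable_one_add_norm (by push_cast; linarith)).const_mul C, fun t ht x => ?_⟩
  have hx : 0 < 1 + ‖x‖ := by positivity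
  beta_reduce
  rw [Real.rpow_neg hx.le, Real.rpow_natCast, ← div_eq_mul_inv, le_div_iff₀ (by positivity),
    mul_comm]
  exact hC t ht x

theorem RapidDecay.integrable {μ : Measure E} [μ.IsAddHaarMeasure]
    {f : ℝ × E → F} (hf : RapidDecay f) (hc : Continuous f) (t : ℝ) :
    Integrable (fun x => f (t, x)) μ := by
  obtain ⟨b, hb, h⟩ := hf.exists_integrable_bound μ |t|
  exact hb.mono' (by fun_prop : Continuous fun x => f (t, x)).aestronglyMeasurable
    (.of_forall (h t le_rfl))

/-- The integral of a directional derivative vanishes. -/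
theorem integral_eq_zero_of_hasLineDerivAt {μ : Measure E} [μ.IsAddHaarMeasure]
    {g g' : E → ℝ} {e : E} (hg : Integrable g μ) (hg' : Integrable g' μ)
    (h : ∀ x, HasLineDerivAt ℝ g (g' x) x e) : ∫ x, g' x ∂μ = 0 := by
  simpa using integral_bilinear_hasLineDerivAt_right_eq_neg_left_of_integrable
    (μ := μ) (f := fun _ => (1 : ℝ)) (f' := fun _ => 0) (g := g) (g' := g') (v := e)
    (B := ContinuousLinearMap.mul ℝ ℝ) (by simp) (by simpa using hg') (by simpa using hg)
    (fun x _ => by simpa [HasLineDerivAt] using hasDerivAt_const (0 : ℝ) (1 : ℝ))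
    (fun x _ => h x)

end Decay

section SpatialDerivatives

variable {E F : Type*} [NormedAddCommGroup E] [NormedSpace ℝ E] [NormedAddCommGroup F]
  [NormedSpace ℝ F]

theorem hasLineDerivAt_prodMk_left {f : ℝ × E → F} {t : ℝ} {x : E}
    (hf : DifferentiableAt ℝ f (t, x)) (e : E) :
    HasLineDerivAt ℝ (fun y => f (t, y)) (fderiv ℝ f (t, x) (0, e)) x e := by
  simpa [Function.comp_def] using
    (hf.hasFDerivAt.comp x (hasFDerivAt_prodMk_right t x)).hasLineDerivAt e

theorem fderiv_prodMk_left_apply {f : ℝ × E → F} (hf : Differentiable ℝ f) (t : ℝ) (x e : E) :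
    fderiv ℝ (fun y => f (t, y)) x e = fderiv ℝ f (t, x) (0, e) := by
  have hd : DifferentiableAt ℝ (fun y => f (t, y)) x := by fun_prop
  exact (hd.hasFDerivAt.hasLineDerivAt e).unique (hasLineDerivAt_prodMk_left (hf _) e)

theorem contDiff_fderiv_apply_const {f : E → F} (hf : ContDiff ℝ (⊤ : ℕ∞) f) (e : E) :
    ContDiff ℝ (⊤ : ℕ∞) fun p => fderiv ℝ f p e :=
  (hf.fderiv_right (by simp)).clm_apply contDiff_const

theorem norm_fderiv_apply_le_iteratedFDeriv_one (f : E → F) {x e : E} (he : ‖e‖ ≤ 1) :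
    ‖fderiv ℝ f x e‖ ≤ ‖iteratedFDeriv ℝ 1 f x‖ := by
  rw [norm_iteratedFDeriv_one]
  exact (fderiv ℝ f x).unit_le_opNorm e he

theorem norm_fderiv_fderiv_apply_le_iteratedFDeriv_two {f : E → F}
    (hf : ContDiff ℝ (⊤ : ℕ∞) f) {x e : E} (he : ‖e‖ ≤ 1) :
    ‖fderiv ℝ (fun y => fderiv ℝ f y e) x e‖ ≤ ‖iteratedFDeriv ℝ 2 f x‖ := by
  have hd : DifferentiableAt ℝ (fderiv ℝ f) x :=
    (hf.fderiv_right (m := 1) (by norm_cast)).differentiable (by simp) x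
  rw [← norm_iteratedFDeriv_fderiv, norm_iteratedFDeriv_one,
    fderiv_clm_apply hd (differentiableAt_const e)]
  simpa using ((fderiv ℝ (fderiv ℝ f) x e).unit_le_opNorm e he).trans
    ((fderiv ℝ (fderiv ℝ f) x).unit_le_opNorm e he)

end SpatialDerivatives

section Flux

open Complex

/-- Derivative of the `j`-th component of the mass flux of the Schrödinger equation. -/
theorem hasLineDerivAt_mass_flux {E : Type*} [AddCommGroup E] [Module ℝ E] {w u : E → ℂ}
    {b : E → ℝ} {u' : ℂ} {b' : ℝ} {x e : E} (hw : HasLineDerivAt ℝ w (u x) x e)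
    (hu : HasLineDerivAt ℝ u u' x e) (hb : HasLineDerivAt ℝ b b' x e) :
    HasLineDerivAt ℝ (fun y => inner ℝ (w y) (I * u y) + (-1 / 2) * (b y * ‖w y‖ ^ 2))
      (inner ℝ (w x) (I * u')
        + ((-1 / 2) * (b' * ‖w x‖ ^ 2) + (-1) * (b x * inner ℝ (w x) (u x)))) x e := by
  unfold HasLineDerivAt at *
  refine ((hw.inner ℝ (hu.const_mul I)).add
    ((hb.mul hw.norm_sq).const_mul (-1 / 2))).congr_deriv ?_
  simp only [zero_smul, add_zero, Complex.inner, mul_re, mul_im, conj_re, conj_im, I_re, I_im]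
  ring

theorem two_mul_inner_eq_of_schrodinger {ι : Type*} [Fintype ι] {z zt V : ℂ} {u u' : ι → ℂ}
    {b b' : ι → ℝ}
    (h : 2 * I * zt + (∑ j, u' j) + I * (∑ j, (b j : ℂ) * u j) + V * z = 0) :
    2 * inner ℝ z zt =
      (∑ j, (inner ℝ z (I * u' j)
        + ((-1 / 2) * (b' j * ‖z‖ ^ 2) + (-1) * (b j * inner ℝ z (u j)))))
      + ((1 / 2) * (∑ j, b' j) - V.im) * ‖z‖ ^ 2 := by
  have hzt : (2 : ℝ) • zt = I * (∑ j, u' j) - (∑ j, b j • u j) + I * (V * z) := by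
    simp only [real_smul, ofReal_ofNat]
    linear_combination (-I) * h + (2 * zt + ∑ j, (b j : ℂ) * u j) * I_mul_I
  have hV : inner ℝ z (I * (V * z)) = -(V.im * ‖z‖ ^ 2) := by
    rw [← normSq_eq_norm_sq, normSq_apply]
    simp only [Complex.inner, mul_re, mul_im, conj_re, conj_im, I_re, I_im]
    ring
  rw [← real_inner_smul_right, hzt, inner_add_right, inner_sub_right, hV, Finset.mul_sum,
    inner_sum, inner_sum, Finset.sum_add_distrib, Finset.sum_add_distrib, ← Finset.mul_sum,
    ← Finset.mul_sum, ← Finset.sum_mul]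
  simp only [real_inner_smul_right]
  ring

end Flux

/-- The mass-derivative identity (C.2): if `v` solves the Schrödinger equation
`2i∂_t v + Δv + iB·∇v + Vv = 0` with `B` real, then
`M'(t) = ∫ ((1/2) div B − Im V) |v|²`; in particular if `B` is divergence-free and `V` is
real then the mass is conserved. -/
theorem schrodinger_mass_derivative (d : ℕ) (hd : 1 ≤ d)
    (B : Fin d → ℝ × EuclideanSpace ℝ (Fin d) → ℝ)
    (V : ℝ × EuclideanSpace ℝ (Fin d) → ℂ)
    (v : ℝ × EuclideanSpace ℝ (Fin d) → ℂ)
    (hB : ∀ j, ContDiff ℝ (⊤ : ℕ∞) (B j))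
    (hBpoly : ∀ (j : Fin d) (n : ℕ), ∃ C : ℝ, ∃ k : ℕ,
      ∀ p, ‖iteratedFDeriv ℝ n (B j) p‖ ≤ C * (1 + ‖p‖) ^ k)
    (hV : ContDiff ℝ (⊤ : ℕ∞) V)
    (hVpoly : ∀ n : ℕ, ∃ C : ℝ, ∃ k : ℕ,
      ∀ p, ‖iteratedFDeriv ℝ n V p‖ ≤ C * (1 + ‖p‖) ^ k)
    (hv : ContDiff ℝ (⊤ : ℕ∞) v)
    (hvSchwartz : ∀ R : ℝ, ∀ k n : ℕ, ∃ C : ℝ, ∀ t : ℝ, |t| ≤ R →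
      ∀ x : EuclideanSpace ℝ (Fin d),
        ‖x‖ ^ k * ‖iteratedFDeriv ℝ n (fun y => v (t, y)) x‖ ≤ C)
    (hvtSchwartz : ∀ R : ℝ, ∀ k n : ℕ, ∃ C : ℝ, ∀ t : ℝ, |t| ≤ R →
      ∀ x : EuclideanSpace ℝ (Fin d),
        ‖x‖ ^ k * ‖iteratedFDeriv ℝ n (fun y => Ptc d v (t, y)) x‖ ≤ C)
    (heq : ∀ p, 2 * Complex.I * Ptc d v p + (∑ j, Pxc d j (Pxc d j v) p)
      + Complex.I * (∑ j, (B j p : ℂ) * Pxc d j v p) + V p * v p = 0) :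
    (∀ t : ℝ,
      HasDerivAt (fun s => ∫ x : EuclideanSpace ℝ (Fin d), ‖v (s, x)‖ ^ 2)
        (∫ x : EuclideanSpace ℝ (Fin d),
          ((1 / 2) * (∑ j, Pxr d j (B j) (t, x)) - (V (t, x)).im) * ‖v (t, x)‖ ^ 2) t) ∧
    ((∀ p, (∑ j, Pxr d j (B j) p) = 0) → (∀ p, (V p).im = 0) →
      ∀ t₁ t₂ : ℝ, (∫ x : EuclideanSpace ℝ (Fin d), ‖v (t₁, x)‖ ^ 2)
        = ∫ x : EuclideanSpace ℝ (Fin d), ‖v (t₂, x)‖ ^ 2) := by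
  have hvd : Differentiable ℝ v := hv.differentiable (by simp)
  have hu (j) : ContDiff ℝ (⊤ : ℕ∞) (Pxc d j v) := contDiff_fderiv_apply_const hv _
  have hud (j) : Differentiable ℝ (Pxc d j v) := (hu j).differentiable (by simp)
  have hu' (j) : ContDiff ℝ (⊤ : ℕ∞) (Pxc d j (Pxc d j v)) :=
    contDiff_fderiv_apply_const (hu j) _
  have hvt : ContDiff ℝ (⊤ : ℕ∞) (Ptc d v) := contDiff_fderiv_apply_const hv _
  have hBd (j) : Differentiable ℝ (B j) := (hB j).differentiable (by simp)
  have hB' (j) : ContDiff ℝ (⊤ : ℕ∞) (Pxr d j (B j)) := contDiff_fderiv_apply_const (hB j) _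
  have he (j : Fin d) : ‖EuclideanSpace.single j (1 : ℝ)‖ ≤ 1 := by simp
  have hPxc (j t) : (fun y => Pxc d j v (t, y)) =
      fun y => fderiv ℝ (fun z => v (t, z)) y (EuclideanSpace.single j 1) :=
    funext fun y => (fderiv_prodMk_left_apply hvd t y _).symm
  have rv : RapidDecay v := .of_pow_mul_le fun R k => by simpa using hvSchwartz R k 0
  have rvt : RapidDecay (Ptc d v) := .of_pow_mul_le fun R k => by simpa using hvtSchwartz R k 0
  have ru (j) : RapidDecay (Pxc d j v) := .of_pow_mul_le fun R k => by
    obtain ⟨C, hC⟩ := hvSchwartz R k 1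
    refine ⟨C, fun t ht x => le_trans ?_ (hC t ht x)⟩
    rw [congrFun (hPxc j t) x]
    gcongr
    exact norm_fderiv_apply_le_iteratedFDeriv_one _ (he j)
  have ru' (j) : RapidDecay (Pxc d j (Pxc d j v)) := .of_pow_mul_le fun R k => by
    obtain ⟨C, hC⟩ := hvSchwartz R k 2
    refine ⟨C, fun t ht x => le_trans ?_ (hC t ht x)⟩
    rw [Pxc, ← fderiv_prodMk_left_apply (hud j), hPxc]
    gcongr
    exact norm_fderiv_fderiv_apply_le_iteratedFDeriv_two (by fun_prop) (he j)
  have pB (j) : SpatialPolyGrowth (B j) := by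
    obtain ⟨C, k, h⟩ := hBpoly j 0
    exact .of_norm_le (C := C) (k := k) (by simpa using h)
  have pB' (j) : SpatialPolyGrowth (Pxr d j (B j)) := by
    obtain ⟨C, k, h⟩ := hBpoly j 1
    refine .of_norm_le (C := C) (k := k) fun p => le_trans ?_ (h p)
    exact norm_fderiv_apply_le_iteratedFDeriv_one _ (by simp)
  have pV : SpatialPolyGrowth V := by
    obtain ⟨C, k, h⟩ := hVpoly 0
    exact .of_norm_le (C := C) (k := k) (by simpa using h)
  have rvv : RapidDecay fun p => ‖v p‖ ^ 2 := by simpa using rv.inner rv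
  have main (t : ℝ) : HasDerivAt (fun s => ∫ x : EuclideanSpace ℝ (Fin d), ‖v (s, x)‖ ^ 2)
      (∫ x : EuclideanSpace ℝ (Fin d),
        ((1 / 2) * (∑ j, Pxr d j (B j) (t, x)) - (V (t, x)).im) * ‖v (t, x)‖ ^ 2) t := by
    obtain ⟨b, hb, hbound⟩ :=
      ((rv.inner rvt).const_mul 2).exists_integrable_bound volume (|t| + 1)
    have hderiv := (hasDerivAt_integral_of_dominated_loc_of_deriv_le
      (F := fun s x => ‖v (s, x)‖ ^ 2) (F' := fun s x => 2 * inner ℝ (v (s, x)) (Ptc d v (s, x)))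
      (μ := volume) (Metric.ball_mem_nhds t one_pos)
      (.of_forall fun s => (rvv.integrable (by fun_prop) s).aestronglyMeasurable)
      (rvv.integrable (by fun_prop) t)
      (((rv.inner rvt).const_mul 2).integrable (by fun_prop) t).aestronglyMeasurable
      (.of_forall fun x s hs => hbound s (by
        rw [Metric.mem_ball, Real.dist_eq] at hs
        linarith [abs_sub_abs_le_abs_sub s t]) x)
      hb
      (.of_forall fun x s _ => by
        have := (hvd (s, x)).hasFDerivAt.comp_hasDerivAt s
          ((hasDerivAt_id s).prodMk (hasDerivAt_const s x))
        exact HasDerivAt.norm_sq this)).2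
    refine hderiv.congr_deriv ?_
    have rflux (j) := (rv.inner (ru j).I_mul).add ((rvv.mul (pB j)).const_mul (-1 / 2))
    have rflux' (j) := (rv.inner (ru' j).I_mul).add (((rvv.mul (pB' j)).const_mul (-1 / 2)).add
      (((rv.inner (ru j)).mul (pB j)).const_mul (-1)))
    have iflux' (j) := (rflux' j).integrable (μ := volume) (by fun_prop) t
    have hzero (j) := integral_eq_zero_of_hasLineDerivAt
      ((rflux j).integrable (μ := volume) (by fun_prop) t) (iflux' j)
      fun x => hasLineDerivAt_mass_flux (hasLineDerivAt_prodMk_left (hvd (t, x)) _)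
        (hasLineDerivAt_prodMk_left (hud j (t, x)) _)
        (hasLineDerivAt_prodMk_left (hBd j (t, x)) _)
    have isource : Integrable (fun x : EuclideanSpace ℝ (Fin d) =>
        ((1 / 2) * (∑ j, Pxr d j (B j) (t, x)) - (V (t, x)).im) * ‖v (t, x)‖ ^ 2) volume := by
      have i₁ := integrable_finsetSum Finset.univ fun j _ =>
        (rvv.mul (pB' j)).integrable (μ := volume) (by fun_prop) t
      have i₂ := (rvv.mul pV.im).integrable (μ := volume) (by fun_prop) t
      refine ((i₁.const_mul (1 / 2)).sub i₂).congr (.of_forall fun x => ?_)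
      simp only [Pi.sub_apply, ← Finset.sum_mul]
      ring
    rw [integral_congr_ae (.of_forall fun x => two_mul_inner_eq_of_schrodinger
        (u := fun j => Pxc d j v (t, x)) (u' := fun j => Pxc d j (Pxc d j v) (t, x))
        (b := fun j => B j (t, x)) (b' := fun j => Pxr d j (B j) (t, x)) (heq (t, x))),
      integral_add (integrable_finsetSum _ fun j _ => iflux' j) isource,
      integral_finsetSum _ fun j _ => iflux' j, Finset.sum_congr rfl fun j _ => hzero j]
    simp
  refine ⟨main, fun hdiv him t₁ t₂ => ?_⟩
  refine is_const_of_deriv_eq_zero (fun t => (main t).differentiableAt) (fun t => ?_) t₁ t₂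
  rw [(main t).deriv]
  simp [hdiv, him]
end

section
/- Under the hypotheses in the context, suppose moreover that there is a constant C ≥ 0 with |div_x B(t,x)| ≤ C (1 + t²)^{−1} and |Im V(t,x)| ≤ C (1 + t²)^{−1} for all (t,x) ∈ ℝ × ℝ^d, and that ∫_{ℝ^d} |v(t,x)|² dx → 0 as t → −∞. Then v vanishes identically on ℝ × ℝ^d. -/
open MeasureTheory

open scoped SchwartzMap LineDeriv ContDiff

/-- Grönwall's inequality with the integrable rate `K (1 + t²)⁻¹` and vanishing data at `-∞`. -/
lemma nonpos_of_deriv_le_of_tendsto_atBot {M M' : ℝ → ℝ} {K : ℝ}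
    (hM : ∀ t, HasDerivAt M (M' t) t) (hle : ∀ t, M' t ≤ K * (1 + t ^ 2)⁻¹ * M t)
    (hlim : Filter.Tendsto M Filter.atBot (nhds 0)) (t : ℝ) : M t ≤ 0 := by
  have hder : ∀ s, HasDerivAt (fun r => M r * Real.exp (-K * Real.arctan r))
      (M' s * Real.exp (-K * Real.arctan s) +
        M s * (Real.exp (-K * Real.arctan s) * (-K * (1 / (1 + s ^ 2))))) s := fun s =>
    (hM s).mul ((Real.hasDerivAt_arctan s).const_mul (-K)).exp
  have hanti : Antitone (fun r => M r * Real.exp (-K * Real.arctan r)) := by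
    refine antitone_of_hasDerivAt_nonpos hder fun s => ?_
    have h := mul_le_mul_of_nonneg_right (hle s) (Real.exp_pos (-K * Real.arctan s)).le
    simp only [Pi.zero_apply, one_div]
    linarith
  have harctan : Filter.Tendsto Real.arctan Filter.atBot (nhds (-(Real.pi / 2))) :=
    tendsto_nhds_of_tendsto_nhdsWithin Real.tendsto_arctan_atBot
  have hlim' : Filter.Tendsto (fun r => M r * Real.exp (-K * Real.arctan r)) Filter.atBot
      (nhds 0) := by
    simpa using hlim.mul ((Real.continuous_exp.tendsto _).comp (harctan.const_mul (-K)))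
  exact nonpos_of_mul_nonpos_left (hanti.ge_of_tendsto hlim' t) (Real.exp_pos _)

section Energy

variable {D ι : Type*} [NormedAddCommGroup D] [NormedSpace ℝ D] [FiniteDimensional ℝ D]
  [MeasurableSpace D] [BorelSpace D]

lemma integrable_inner_schwartz (μ : Measure D) [μ.IsAddHaarMeasure] (f g : 𝓢(D, ℂ)) :
    Integrable (fun x => inner ℝ (f x) (g x)) μ :=
  (SchwartzMap.pairing (innerSL ℝ) f g).integrable

lemma integral_inner_I_mul_lineDeriv_lineDeriv (μ : Measure D) [μ.IsAddHaarMeasure]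
    (u : 𝓢(D, ℂ)) (e : D) :
    ∫ x, inner ℝ (u x) (Complex.I * ∂_{e} (∂_{e} u) x) ∂μ = 0 := by
  have h := SchwartzMap.integral_bilinear_lineDerivOp_right_eq_neg_left (μ := μ) u
    (∂_{e} u) ((innerSL ℝ).bilinearComp (ContinuousLinearMap.id ℝ ℂ)
      (ContinuousLinearMap.mul ℝ ℂ Complex.I)) e
  simp only [ContinuousLinearMap.bilinearComp_apply, ContinuousLinearMap.id_apply,
    innerSL_apply_apply, ContinuousLinearMap.mul_apply'] at h
  rw [h]
  simp only [Complex.inner, Complex.mul_re, Complex.conj_re, Complex.conj_im, Complex.I_re,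
    Complex.I_im, Complex.mul_im, zero_mul, one_mul, zero_sub, zero_add]
  simp [mul_comm]

/-- `2 ∫ b ⟪u, ∂u⟫ = - ∫ (∂b) |u|²`, together with the integrability of both integrands. -/
lemma integral_inner_smul_lineDeriv (μ : Measure D) [μ.IsAddHaarMeasure]
    (u : 𝓢(D, ℂ)) {b : D → ℝ} (hb : b.HasTemperateGrowth) (e : D) :
    Integrable (fun x => fderiv ℝ b x e * ‖u x‖ ^ 2) μ ∧
    Integrable (fun x => inner ℝ (u x) (b x • ∂_{e} u x)) μ ∧
    2 * ∫ x, inner ℝ (u x) (b x • ∂_{e} u x) ∂μ = - ∫ x, fderiv ℝ b x e * ‖u x‖ ^ 2 ∂μ := by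
  set g : 𝓢(D, ℂ) := SchwartzMap.smulLeftCLM ℂ b u with hg
  have hgx : ∀ x, g x = b x • u x := SchwartzMap.smulLeftCLM_apply_apply hb u
  have hdg : ∀ x, ∂_{e} g x = fderiv ℝ b x e • u x + b x • ∂_{e} u x := by
    intro x
    have hfun : (g : D → ℂ) = fun y => b y • u y := funext hgx
    rw [SchwartzMap.lineDerivOp_apply_eq_fderiv, SchwartzMap.lineDerivOp_apply_eq_fderiv, hfun,
      fderiv_fun_smul (hb.1.differentiable (by simp) x) u.differentiableAt]
    simp [add_comm]
  have h1 : Integrable (fun x => inner ℝ (u x) (b x • ∂_{e} u x)) μ := by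
    refine (integrable_inner_schwartz μ g (∂_{e} u)).congr (.of_forall fun x => ?_)
    simp only [hgx, real_inner_smul_left, real_inner_smul_right]
  have h2 : Integrable (fun x => fderiv ℝ b x e * ‖u x‖ ^ 2) μ := by
    refine ((integrable_inner_schwartz μ u (∂_{e} g)).sub h1).congr (.of_forall fun x => ?_)
    simp only [Pi.sub_apply, hdg, inner_add_right, real_inner_smul_right, real_inner_self_eq_norm_sq]
    ring
  refine ⟨h2, h1, ?_⟩
  have h := SchwartzMap.integral_bilinear_lineDerivOp_right_eq_neg_left (μ := μ) g u
    (innerSL ℝ) e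
  have hl : ∫ x, innerSL ℝ (g x) (∂_{e} u x) ∂μ = ∫ x, inner ℝ (u x) (b x • ∂_{e} u x) ∂μ := by
    congr 1 with x
    simp only [hgx, innerSL_apply_apply, real_inner_smul_left, real_inner_smul_right]
  have hr : ∫ x, innerSL ℝ (∂_{e} g x) (u x) ∂μ =
      ∫ x, fderiv ℝ b x e * ‖u x‖ ^ 2 ∂μ + ∫ x, inner ℝ (u x) (b x • ∂_{e} u x) ∂μ := by
    rw [← integral_add h2 h1]
    congr 1 with x
    simp only [hdg, innerSL_apply_apply, inner_add_left,
      real_inner_smul_right, real_inner_self_eq_norm_sq, real_inner_comm]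
  rw [hl, hr] at h
  linarith

/-- The mass identity at a fixed time. -/
lemma integral_two_mul_inner_of_schrodinger [Fintype ι] (μ : Measure D) [μ.IsAddHaarMeasure]
    (u w : 𝓢(D, ℂ)) {b : ι → D → ℝ} (hb : ∀ j, (b j).HasTemperateGrowth) {V : D → ℂ}
    (hV : V.HasTemperateGrowth) (e : ι → D)
    (heq : ∀ x, 2 * Complex.I * w x + ∑ j, ∂_{e j} (∂_{e j} u) x
      + Complex.I * ∑ j, (b j x : ℂ) * ∂_{e j} u x + V x * u x = 0) :
    Integrable (fun x => (2⁻¹ * ∑ j, fderiv ℝ (b j) x (e j) - (V x).im) * ‖u x‖ ^ 2) μ ∧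
    ∫ x, 2 * inner ℝ (u x) (w x) ∂μ =
      ∫ x, (2⁻¹ * ∑ j, fderiv ℝ (b j) x (e j) - (V x).im) * ‖u x‖ ^ 2 ∂μ := by
  have hVint : Integrable (fun x => (V x).im * ‖u x‖ ^ 2) μ := by
    refine ((SchwartzMap.pairing ((innerSL ℝ).bilinearComp
      (ContinuousLinearMap.mul ℝ ℂ Complex.I) (ContinuousLinearMap.id ℝ ℂ))
      u (SchwartzMap.smulLeftCLM ℂ V u)).integrable (μ := μ)).congr (.of_forall fun x => ?_)
    simp [SchwartzMap.smulLeftCLM_apply_apply hV, Complex.inner, Complex.sq_norm,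
      Complex.normSq_apply]
    ring
  have hΔint : ∀ j, Integrable (fun x => inner ℝ (u x) (Complex.I * ∂_{e j} (∂_{e j} u) x)) μ :=
    fun j => (SchwartzMap.pairing ((innerSL ℝ).bilinearComp (ContinuousLinearMap.id ℝ ℂ)
      (ContinuousLinearMap.mul ℝ ℂ Complex.I)) u (∂_{e j} (∂_{e j} u))).integrable
  have hbu := fun j => integral_inner_smul_lineDeriv μ u (hb j) (e j)
  have hpt : ∀ x, 2 * inner ℝ (u x) (w x) =
      ∑ j, inner ℝ (u x) (Complex.I * ∂_{e j} (∂_{e j} u) x)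
        - ∑ j, inner ℝ (u x) (b j x • ∂_{e j} u x) - (V x).im * ‖u x‖ ^ 2 := by
    intro x
    have hw : (2 : ℝ) • w x = ∑ j, Complex.I * ∂_{e j} (∂_{e j} u) x
        - ∑ j, b j x • ∂_{e j} u x + Complex.I * V x * u x := by
      simp only [Complex.real_smul, ← Finset.mul_sum]
      push_cast
      linear_combination (-Complex.I) * heq x +
        (2 * w x + ∑ j, (b j x : ℂ) * ∂_{e j} u x) * Complex.I_sq
    have hVu : inner ℝ (u x) (Complex.I * V x * u x) = -((V x).im * ‖u x‖ ^ 2) := by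
      simp [Complex.inner, Complex.sq_norm, Complex.normSq_apply]
      ring
    rw [← real_inner_smul_right, hw, inner_add_right, inner_sub_right, inner_sum, inner_sum, hVu]
    ring
  have hdivint : Integrable (fun x => ∑ j, fderiv ℝ (b j) x (e j) * ‖u x‖ ^ 2) μ :=
    integrable_finsetSum _ fun j _ => (hbu j).1
  have hrhs : ∀ x, (2⁻¹ * ∑ j, fderiv ℝ (b j) x (e j) - (V x).im) * ‖u x‖ ^ 2 =
      2⁻¹ * (∑ j, fderiv ℝ (b j) x (e j) * ‖u x‖ ^ 2) - (V x).im * ‖u x‖ ^ 2 := by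
    intro x
    rw [← Finset.sum_mul]
    ring
  simp only [hpt, hrhs]
  refine ⟨(hdivint.const_mul _).sub hVint, ?_⟩
  rw [integral_sub _ hVint, integral_sub, integral_sub (hdivint.const_mul _) hVint,
    integral_const_mul, integral_finsetSum _ fun j _ => hΔint j,
    integral_finsetSum _ fun j _ => (hbu j).2.1, integral_finsetSum _ fun j _ => (hbu j).1,
    Finset.mul_sum, Finset.sum_eq_zero fun j _ =>
      integral_inner_I_mul_lineDeriv_lineDeriv μ u (e j), zero_sub, ← Finset.sum_neg_distrib]
  · congr 1
    refine Finset.sum_congr rfl fun j _ => ?_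
    linarith [(hbu j).2.2]
  · exact integrable_finsetSum _ fun j _ => hΔint j
  · exact integrable_finsetSum _ fun j _ => (hbu j).2.1
  · exact (integrable_finsetSum _ fun j _ => hΔint j).sub
      (integrable_finsetSum _ fun j _ => (hbu j).2.1)

end Energy

section Slices

variable {D F : Type*} [NormedAddCommGroup D] [NormedSpace ℝ D]
  [NormedAddCommGroup F] [NormedSpace ℝ F]

lemma hasTemperateGrowth_slice {f : ℝ × D → F} (hf : f.HasTemperateGrowth) (t : ℝ) :
    (fun x => f (t, x)).HasTemperateGrowth := by
  have h : (fun x : D => ((t, x) : ℝ × D)).HasTemperateGrowth := by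
    have := (Function.HasTemperateGrowth.const (E := D) ((t, 0) : ℝ × D)).add
      (ContinuousLinearMap.inr ℝ ℝ D).hasTemperateGrowth
    convert this using 1
    ext x <;> simp
  exact hf.comp h

lemma fderiv_slice {f : ℝ × D → F} (hf : Differentiable ℝ f) (t : ℝ) (x e : D) :
    fderiv ℝ (fun y => f (t, y)) x e = fderiv ℝ f (t, x) (0, e) := by
  have h := (hf (t, x)).hasFDerivAt.comp x (hasFDerivAt_prodMk_right t x)
  rw [show (fun y => f (t, y)) = f ∘ fun y => (t, y) from rfl, h.fderiv]
  simp

end Slices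

/-- Differentiation of the mass under the integral sign, for a curve of functions with uniform
rapid decay. -/
lemma hasDerivAt_integral_norm_sq {D : Type*} [NormedAddCommGroup D] [NormedSpace ℝ D]
    [MeasurableSpace D] [BorelSpace D] [SecondCountableTopology D] (μ : Measure D)
    [μ.HasTemperateGrowth]
    {v v' : ℝ × D → ℂ} (hv : Continuous v) (hv' : Continuous v')
    (hd : ∀ t x, HasDerivAt (fun s => v (s, x)) (v' (t, x)) t)
    (hdec : ∀ R : ℝ, ∀ k : ℕ, ∃ C : ℝ, ∀ t : ℝ, |t| ≤ R → ∀ x, ‖x‖ ^ k * ‖v (t, x)‖ ≤ C)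
    (hdec' : ∀ R : ℝ, ∃ C : ℝ, ∀ t : ℝ, |t| ≤ R → ∀ x, ‖v' (t, x)‖ ≤ C)
    (hint : ∀ t, Integrable (fun x => ‖v (t, x)‖ ^ 2) μ) (t : ℝ) :
    HasDerivAt (fun s => ∫ x, ‖v (s, x)‖ ^ 2 ∂μ)
      (∫ x, 2 * inner ℝ (v (t, x)) (v' (t, x)) ∂μ) t := by
  obtain ⟨C₀, hC₀⟩ := hdec (|t| + 1) 0
  obtain ⟨C₁, hC₁⟩ := hdec (|t| + 1) (0 + μ.integrablePower)
  obtain ⟨C₂, hC₂⟩ := hdec' (|t| + 1)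
  refine (hasDerivAt_integral_of_dominated_loc_of_deriv_le (s := Metric.ball t 1)
    (bound := fun x => 2 * (2 ^ μ.integrablePower * (C₀ + C₁) *
      (1 + ‖x‖) ^ (-(μ.integrablePower : ℝ)) * C₂))
    (F := fun s x => ‖v (s, x)‖ ^ 2) (F' := fun s x => 2 * inner ℝ (v (s, x)) (v' (s, x)))
    (Metric.ball_mem_nhds t one_pos) (.of_forall fun s => (hint s).aestronglyMeasurable) (hint t)
    ?_ (.of_forall fun x s hs => ?_) ?_ (.of_forall fun x s _ => (hd s x).norm_sq)).2
  · exact Continuous.aestronglyMeasurable (by fun_prop)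
  · have hs' : |s| ≤ |t| + 1 := by
      have h1 : |s - t| < 1 := by simpa [Real.dist_eq] using hs
      have h2 := abs_add_le (s - t) t
      rw [sub_add_cancel] at h2
      linarith
    have h := pow_mul_le_of_le_of_pow_mul_le (norm_nonneg x) (norm_nonneg (v (s, x)))
      (by simpa using hC₀ s hs' x) (hC₁ s hs' x)
    rw [pow_zero, one_mul] at h
    rw [norm_mul, Real.norm_ofNat]
    gcongr
    exact (norm_inner_le_norm _ _).trans
      (mul_le_mul h (hC₂ s hs' x) (norm_nonneg _) ((norm_nonneg _).trans h))
  · exact (((MeasureTheory.Measure.integrable_pow_neg_integrablePower μ).const_mul _).mul_const _).const_mul _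

/-- Uniqueness for the model Schrödinger operator (Appendix C): if moreover
`|div_x B| ≤ C(1+t²)⁻¹` and `|Im V| ≤ C(1+t²)⁻¹`, and the mass of `v` tends to 0 as
`t → −∞`, then `v ≡ 0`. -/
theorem schrodinger_uniqueness (d : ℕ) (hd : 1 ≤ d)
    (B : Fin d → ℝ × EuclideanSpace ℝ (Fin d) → ℝ)
    (V : ℝ × EuclideanSpace ℝ (Fin d) → ℂ)
    (v : ℝ × EuclideanSpace ℝ (Fin d) → ℂ)
    (hB : ∀ j, ContDiff ℝ (⊤ : ℕ∞) (B j))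
    (hBpoly : ∀ (j : Fin d) (n : ℕ), ∃ C : ℝ, ∃ k : ℕ,
      ∀ p, ‖iteratedFDeriv ℝ n (B j) p‖ ≤ C * (1 + ‖p‖) ^ k)
    (hV : ContDiff ℝ (⊤ : ℕ∞) V)
    (hVpoly : ∀ n : ℕ, ∃ C : ℝ, ∃ k : ℕ,
      ∀ p, ‖iteratedFDeriv ℝ n V p‖ ≤ C * (1 + ‖p‖) ^ k)
    (hv : ContDiff ℝ (⊤ : ℕ∞) v)
    (hvSchwartz : ∀ R : ℝ, ∀ k n : ℕ, ∃ C : ℝ, ∀ t : ℝ, |t| ≤ R →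
      ∀ x : EuclideanSpace ℝ (Fin d),
        ‖x‖ ^ k * ‖iteratedFDeriv ℝ n (fun y => v (t, y)) x‖ ≤ C)
    (hvtSchwartz : ∀ R : ℝ, ∀ k n : ℕ, ∃ C : ℝ, ∀ t : ℝ, |t| ≤ R →
      ∀ x : EuclideanSpace ℝ (Fin d),
        ‖x‖ ^ k * ‖iteratedFDeriv ℝ n (fun y => Ptc d v (t, y)) x‖ ≤ C)
    (heq : ∀ p, 2 * Complex.I * Ptc d v p + (∑ j, Pxc d j (Pxc d j v) p)
      + Complex.I * (∑ j, (B j p : ℂ) * Pxc d j v p) + V p * v p = 0)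
    (C : ℝ) (hC : 0 ≤ C)
    (hdivB : ∀ p : ℝ × EuclideanSpace ℝ (Fin d),
      |∑ j, Pxr d j (B j) p| ≤ C * (1 + p.1 ^ 2)⁻¹)
    (hImV : ∀ p : ℝ × EuclideanSpace ℝ (Fin d),
      |(V p).im| ≤ C * (1 + p.1 ^ 2)⁻¹)
    (hmass : Filter.Tendsto (fun t : ℝ => ∫ x : EuclideanSpace ℝ (Fin d), ‖v (t, x)‖ ^ 2)
      Filter.atBot (nhds 0)) :
    ∀ p, v p = 0 := by
  have hvd : Differentiable ℝ v := hv.differentiable (by simp)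
  have hfd : ContDiff ℝ ∞ (fderiv ℝ v) := hv.fderiv_right (by simp)
  have hPt : ContDiff ℝ ∞ (Ptc d v) := hfd.clm_apply contDiff_const
  have hPx : ∀ j, ContDiff ℝ ∞ (Pxc d j v) := fun j => hfd.clm_apply contDiff_const
  have hslice : ∀ t : ℝ, ContDiff ℝ ∞ fun y : EuclideanSpace ℝ (Fin d) => ((t, y) : ℝ × _) :=
    fun t => contDiff_const.prodMk contDiff_id
  let u : ℝ → 𝓢(EuclideanSpace ℝ (Fin d), ℂ) := fun t =>
    ⟨fun y => v (t, y), hv.comp (hslice t), fun k n =>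
      (hvSchwartz |t| k n).imp fun _ h => h t le_rfl⟩
  let w : ℝ → 𝓢(EuclideanSpace ℝ (Fin d), ℂ) := fun t =>
    ⟨fun y => Ptc d v (t, y), hPt.comp (hslice t), fun k n =>
      (hvtSchwartz |t| k n).imp fun _ h => h t le_rfl⟩
  let e : Fin d → EuclideanSpace ℝ (Fin d) := fun j => EuclideanSpace.single j 1
  have hu1 : ∀ t j x, ∂_{e j} (u t) x = Pxc d j v (t, x) := fun t j x =>
    (SchwartzMap.lineDerivOp_apply_eq_fderiv _ _ _).trans (fderiv_slice hvd t x (e j))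
  have hu2 : ∀ t j x, ∂_{e j} (∂_{e j} (u t)) x = Pxc d j (Pxc d j v) (t, x) := by
    intro t j x
    rw [SchwartzMap.lineDerivOp_apply_eq_fderiv,
      show ((∂_{e j} (u t) : 𝓢(EuclideanSpace ℝ (Fin d), ℂ)) : _ → ℂ) = fun y => Pxc d j v (t, y) from
        funext (hu1 t j)]
    exact fderiv_slice ((hPx j).differentiable (by simp)) t x (e j)
  have hbt : ∀ t j, (fun x => B j (t, x)).HasTemperateGrowth := fun t j =>
    hasTemperateGrowth_slice ⟨hB j, fun n => by
      obtain ⟨C, k, h⟩ := hBpoly j n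
      exact ⟨k, C, h⟩⟩ t
  have hVt : ∀ t, (fun x => V (t, x)).HasTemperateGrowth := fun t =>
    hasTemperateGrowth_slice ⟨hV, fun n => by
      obtain ⟨C, k, h⟩ := hVpoly n
      exact ⟨k, C, h⟩⟩ t
  have hint : ∀ t, Integrable (fun x : EuclideanSpace ℝ (Fin d) => ‖v (t, x)‖ ^ 2) := fun t =>
    (integrable_inner_schwartz volume (u t) (u t)).congr
      (.of_forall fun x => real_inner_self_eq_norm_sq (v (t, x)))
  have hderiv : ∀ t, HasDerivAt (fun s => ∫ x : EuclideanSpace ℝ (Fin d), ‖v (s, x)‖ ^ 2)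
      (∫ x : EuclideanSpace ℝ (Fin d), 2 * inner ℝ (v (t, x)) (Ptc d v (t, x))) t := by
    refine hasDerivAt_integral_norm_sq volume hv.continuous hPt.continuous (fun t x => ?_)
      (fun R k => ?_) (fun R => ?_) hint
    · exact (hvd (t, x)).hasFDerivAt.comp_hasDerivAt t
        ((hasDerivAt_id t).prodMk (hasDerivAt_const t x))
    · simpa using hvSchwartz R k 0
    · simpa using hvtSchwartz R 0 0
  have hle : ∀ t, ∫ x : EuclideanSpace ℝ (Fin d), 2 * inner ℝ (v (t, x)) (Ptc d v (t, x)) ≤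
      (3 / 2 * C) * (1 + t ^ 2)⁻¹ * ∫ x : EuclideanSpace ℝ (Fin d), ‖v (t, x)‖ ^ 2 := by
    intro t
    obtain ⟨hi, hid⟩ := integral_two_mul_inner_of_schrodinger volume (u t) (w t) (hbt t) (hVt t) e
      fun x => by simpa only [hu1, hu2] using! heq (t, x)
    refine hid.trans_le ?_
    rw [← integral_const_mul]
    refine integral_mono hi ((hint t).const_mul _) fun x => ?_
    refine mul_le_mul_of_nonneg_right ?_ (sq_nonneg _)
    have h1 := (le_abs_self _).trans (hdivB (t, x))
    have h2 := (neg_le_abs _).trans (hImV (t, x))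
    have h3 : ∀ j, fderiv ℝ (fun y => B j (t, y)) x (e j) = Pxr d j (B j) (t, x) := fun j =>
      fderiv_slice ((hB j).differentiable (by simp)) t x (e j)
    simp only [h3]
    linarith
  rintro ⟨t, x⟩
  have hzero : ∫ x : EuclideanSpace ℝ (Fin d), ‖v (t, x)‖ ^ 2 = 0 :=
    le_antisymm (nonpos_of_deriv_le_of_tendsto_atBot hderiv hle hmass t)
      (integral_nonneg fun _ => sq_nonneg _)
  rw [integral_eq_zero_iff_of_nonneg (fun _ => sq_nonneg _) (hint t)] at hzero
  have hcont : Continuous fun x : EuclideanSpace ℝ (Fin d) => ‖v (t, x)‖ ^ 2 :=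
    ((u t).continuous.norm).pow 2
  exact norm_eq_zero.1 (sq_eq_zero_iff.1
    (congrFun ((hcont.ae_eq_iff_eq volume continuous_const).1 hzero) x))
end
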